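/- Let f : ℝ^d → 𝒴 be any deterministic function into a finite set of classes 𝒴, let μ ∈ ℝ^d and σ₁,…,σ_d > 0, and let ε be a random vector in ℝ^d whose i-th coordinate is an independent Gaussian N(μ_i, σ_i²). Suppose that for a specific x ∈ ℝ^d there exist a class c_A ∈ 𝒴 and p_A ∈ [0,1] with P(f(x+ε)=c_A) ≥ p_A ≥ 1/2. Then for every δ ∈ ℝ^d with ‖δ‖₂ < R, where R = (min_i σ_i)·Φ⁻¹(p_A), one has P(f(x+δ+ε)=c_A) > 1/2. -/

import Mathlib

open MeasureTheory ProbabilityTheory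

/-- The cumulative distribution function of the standard normal distribution `N(0,1)`. -/
noncomputable def Phi : ℝ → ℝ :=
  fun x => ((gaussianReal 0 1) (Set.Iic x)).toReal

/-- The inverse of the standard normal CDF. -/
noncomputable def PhiInv : ℝ → ℝ := Function.invFun Phi

lemma aux_Phi_eq_cdf : Phi = cdf (gaussianReal 0 1) := by
  funext x
  rw [cdf_eq_real]; rfl

lemma aux_Phi_cont : Continuous Phi := by
  rw [aux_Phi_eq_cdf]
  rw [continuous_iff_continuousAt]
  intro x
  rw [(monotone_cdf _).continuousAt_iff_leftLim_eq_rightLim, StieltjesFunction.rightLim_eq]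
  have h := (cdf (gaussianReal 0 1)).measure_singleton x
  have := nullSingletonClass_gaussianReal (μ := 0) (v := 1) one_ne_zero
  rw [measure_cdf, measure_singleton] at h
  have h2 := ENNReal.ofReal_eq_zero.1 h.symm
  have h3 := (monotone_cdf (gaussianReal 0 1)).leftLim_le (le_refl x)
  linarith

lemma aux_Phi_strictMono : StrictMono Phi := by
  intro x y hxy
  have h1 : gaussianReal 0 1 (Set.Ioc x y) ≠ 0 := by
    intro h
    have := gaussianReal_absolutelyContinuous' 0 (v := 1) one_ne_zero h
    simp at this
    linarith
  have h2 : gaussianReal 0 1 (Set.Iic y) = gaussianReal 0 1 (Set.Iic x)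
      + gaussianReal 0 1 (Set.Ioc x y) := by
    rw [← measure_union _ measurableSet_Ioc, Set.Iic_union_Ioc_eq_Iic hxy.le]
    exact Set.disjoint_left.2 fun z hz hz' => absurd hz'.1 (not_lt.2 hz)
  simp only [Phi]
  rw [h2, ENNReal.toReal_add (measure_ne_top _ _) (measure_ne_top _ _)]
  have := ENNReal.toReal_pos h1 (measure_ne_top _ _)
  linarith

lemma aux_Phi_zero : Phi 0 = 1 / 2 := by
  have := nullSingletonClass_gaussianReal (μ := 0) (v := 1) one_ne_zero
  have h1 : gaussianReal 0 1 (Set.Iic 0) = gaussianReal 0 1 (Set.Ioi 0) := by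
    have h := gaussianReal_map_neg (μ := 0) (v := 1)
    rw [neg_zero] at h
    conv_lhs => rw [← h]
    rw [Measure.map_apply measurable_neg measurableSet_Iic]
    simp only [Set.neg_preimage, Set.neg_Iic, neg_zero]
    exact measure_congr Ioi_ae_eq_Ici.symm
  have h2 := measure_add_measure_compl (μ := gaussianReal 0 1) (measurableSet_Iic (a := (0:ℝ)))
  rw [Set.compl_Iic, ← h1, measure_univ] at h2
  have h3 := congrArg ENNReal.toReal h2
  rw [ENNReal.toReal_add (measure_ne_top _ _) (measure_ne_top _ _)] at h3
  simp only [Phi]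
  simp at h3
  linarith

lemma aux_Phi_PhiInv {p : ℝ} (h0 : 0 < p) (h1 : p < 1) : Phi (PhiInv p) = p := by
  apply Function.invFun_eq
  have hb : Filter.Tendsto Phi Filter.atBot (nhds 0) := by
    rw [aux_Phi_eq_cdf]; exact tendsto_cdf_atBot _
  have ht : Filter.Tendsto Phi Filter.atTop (nhds 1) := by
    rw [aux_Phi_eq_cdf]; exact tendsto_cdf_atTop _
  exact mem_range_of_exists_le_of_exists_ge aux_Phi_cont
    ((hb.eventually (ge_mem_nhds h0)).exists) ((ht.eventually (le_mem_nhds h1)).exists)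

lemma aux_gauss_Iic (m y : ℝ) {s : ℝ} (hs : 0 < s) {v : NNReal} (hv : (v : ℝ) = s ^ 2) :
    (gaussianReal m v (Set.Iic y)).toReal = Phi ((y - m) / s) := by
  have h : (gaussianReal 0 1).map (fun x => s * x + m) = gaussianReal m v := by
    have : (fun x : ℝ => s * x + m) = (fun x => x + m) ∘ (fun x => s * x) := rfl
    rw [this, ← Measure.map_map (by fun_prop) (by fun_prop), gaussianReal_map_const_mul,
      gaussianReal_map_add_const]
    congr 1
    · simp
    · ext; simp [hv]
  rw [← h, Measure.map_apply (by fun_prop) measurableSet_Iic]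
  simp only [Phi]
  congr 2
  ext x
  simp only [Set.mem_preimage, Set.mem_Iic]
  rw [le_div_iff₀ hs]
  constructor <;> intro _ <;> linarith

lemma aux_NP {Ω : Type*} [MeasurableSpace Ω] (P : Measure Ω) [IsFiniteMeasure P]
    (L : Ω → ENNReal) (A S : Set Ω) (hA : MeasurableSet A) (hS : MeasurableSet S) (k : ENNReal)
    (h1 : ∀ e ∈ S, L e ≤ k) (h2 : ∀ e ∉ S, k ≤ L e) (h : P S ≤ P A) :
    P.withDensity L S ≤ P.withDensity L A := by
  have h3 : P (S \ A) ≤ P (A \ S) := by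
    rw [← measure_inter_add_sdiff S hA, ← measure_inter_add_sdiff A hS, Set.inter_comm A S] at h
    exact (ENNReal.add_le_add_iff_left (measure_ne_top _ _)).1 h
  rw [← measure_inter_add_sdiff S hA, ← measure_inter_add_sdiff A hS, Set.inter_comm A S]
  gcongr 1
  rw [withDensity_apply _ (hS.diff hA), withDensity_apply _ (hA.diff hS)]
  calc ∫⁻ a in S \ A, L a ∂P ≤ ∫⁻ a in S \ A, k ∂P :=
        setLIntegral_mono' (hS.diff hA) fun e he => h1 e he.1
    _ = k * P (S \ A) := by simp
    _ ≤ k * P (A \ S) := by gcongr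
    _ = ∫⁻ a in A \ S, k ∂P := by simp
    _ ≤ _ := setLIntegral_mono' (hA.diff hS) fun e he => h2 e he.2

lemma aux_law {d : ℕ} (m w : Fin d → ℝ) (v : Fin d → NNReal) :
    (Measure.pi fun i => gaussianReal (m i) (v i)).map (fun e => ∑ i, w i * e i) =
      gaussianReal (∑ i, w i * m i) (∑ i, NNReal.mk (w i ^ 2) (sq_nonneg _) * v i) := by
  have h : (fun e : Fin d → ℝ => ∑ i, w i * e i) =
      (fun p => ∑ i, p i) ∘ (fun e i => w i * e i) := rfl
  rw [h, ← Measure.map_map (by fun_prop) (by fun_prop),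
    Measure.pi_map_pi (f := fun i x => w i * x) (fun i => by fun_prop)]
  simp_rw [gaussianReal_map_const_mul]
  apply Measure.ext_of_charFun
  rw [charFun_map_sum_pi_eq_prod]
  ext t
  rw [Finset.prod_apply]
  simp_rw [charFun_gaussianReal]
  rw [← Complex.exp_sum]
  congr 1
  push_cast
  rw [Finset.sum_sub_distrib, Finset.mul_sum, Finset.sum_mul, Finset.sum_mul, Finset.sum_div]

lemma aux_dens1 (m a : ℝ) {v : NNReal} (hv : v ≠ 0) :
    gaussianReal (m + a) v = (gaussianReal m v).withDensity
      (fun x => ENNReal.ofReal (Real.exp ((a * (x - m) - a ^ 2 / 2) / v))) := by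
  rw [gaussianReal_of_var_ne_zero _ hv, gaussianReal_of_var_ne_zero _ hv,
    ← withDensity_mul _ (measurable_gaussianPDF _ _) (by fun_prop)]
  congr 1
  ext x
  simp only [Pi.mul_apply, gaussianPDF]
  rw [← ENNReal.ofReal_mul (gaussianPDFReal_nonneg _ _ _), gaussianPDFReal, gaussianPDFReal,
    mul_assoc (Real.sqrt _)⁻¹, ← Real.exp_add]
  congr 3
  have : (v : ℝ) ≠ 0 := by exact_mod_cast hv
  field_simp
  ring

lemma aux_dens {d : ℕ} (m a : Fin d → ℝ) (v : Fin d → NNReal) (hv : ∀ i, v i ≠ 0) :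
    (Measure.pi fun i => gaussianReal (m i + a i) (v i)) =
      (Measure.pi fun i => gaussianReal (m i) (v i)).withDensity
      (fun x => ENNReal.ofReal (Real.exp (∑ i, (a i * (x i - m i) - a i ^ 2 / 2) / v i))) := by
  symm
  symm
  apply Measure.pi_eq
  intro s hs
  rw [withDensity_apply _ (MeasurableSet.univ_pi hs), ← lintegral_indicator (MeasurableSet.univ_pi hs)]
  have h : ∀ x : Fin d → ℝ, (Set.univ.pi s).indicator
      (fun x => ENNReal.ofReal (Real.exp (∑ i, (a i * (x i - m i) - a i ^ 2 / 2) / v i))) x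
      = ∏ i, (s i).indicator
        (fun y => ENNReal.ofReal (Real.exp ((a i * (y - m i) - a i ^ 2 / 2) / v i))) (x i) := by
    intro x
    by_cases hx : x ∈ Set.univ.pi s
    · rw [Set.indicator_of_mem hx, Real.exp_sum, ENNReal.ofReal_prod_of_nonneg
        (fun i _ => (Real.exp_pos _).le)]
      refine Finset.prod_congr rfl fun i _ => ?_
      rw [Set.indicator_of_mem (hx i trivial)]
    · rw [Set.indicator_of_notMem hx]
      simp only [Set.mem_pi, Set.mem_univ, true_implies, not_forall] at hx
      obtain ⟨i, hi⟩ := hx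
      exact (Finset.prod_eq_zero (Finset.mem_univ i) (Set.indicator_of_notMem hi _)).symm
  simp_rw [h]
  have hm : ∀ i, Measurable ((s i).indicator
        (fun y => ENNReal.ofReal (Real.exp ((a i * (y - m i) - a i ^ 2 / 2) / v i)))) := fun i =>
    Measurable.indicator (by fun_prop) (hs i)
  rw [lintegral_prod_eq_prod_lintegral_of_indepFun Finset.univ
    (fun i (x : Fin d → ℝ) => (s i).indicator
        (fun y => ENNReal.ofReal (Real.exp ((a i * (y - m i) - a i ^ 2 / 2) / v i))) (x i))
    (iIndepFun_pi (X := fun i => (s i).indicator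
        (fun y => ENNReal.ofReal (Real.exp ((a i * (y - m i) - a i ^ 2 / 2) / v i))))
      fun i => (hm i).aemeasurable) (fun i => (hm i).comp (measurable_pi_apply i))]
  refine Finset.prod_congr rfl fun i _ => ?_
  rw [aux_dens1 _ _ (hv i), withDensity_apply _ (hs i), ← lintegral_indicator (hs i)]
  exact (measurePreserving_eval (fun i => gaussianReal (m i) (v i)) i).lintegral_comp (hm i)

lemma aux_shift {d : ℕ} (m a : Fin d → ℝ) (v : Fin d → NNReal) (A : Set (Fin d → ℝ))
    (hA : MeasurableSet A) :
    (Measure.pi fun i => gaussianReal (m i) (v i)) {e | a + e ∈ A} =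
      (Measure.pi fun i => gaussianReal (m i + a i) (v i)) A := by
  have h : (Measure.pi fun i => gaussianReal (m i) (v i)).map (fun e i => a i + e i)
      = Measure.pi fun i => gaussianReal (m i + a i) (v i) := by
    rw [Measure.pi_map_pi (f := fun i x => a i + x) (fun i => by fun_prop)]
    simp_rw [gaussianReal_map_const_add]
  rw [← h, Measure.map_apply (by fun_prop) hA]
  rfl

/-- Randomized smoothing with anisotropic Gaussian noise, binary case. -/
theorem anisotropic_randomized_smoothing_binary
    {d : ℕ} (hd : 0 < d) {Y : Type*} [Fintype Y] [MeasurableSpace Y] [MeasurableSingletonClass Y]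
    (f : (Fin d → ℝ) → Y) (hf : Measurable f)
    (μ : Fin d → ℝ) (σ : Fin d → ℝ) (hσ : ∀ i, 0 < σ i)
    (noise : Measure (Fin d → ℝ))
    (hnoise : noise = Measure.pi fun i : Fin d => gaussianReal (μ i) ((σ i ^ 2).toNNReal))
    (x : Fin d → ℝ) (cA : Y) (pA : ℝ)
    (hpA : pA ∈ Set.Icc (0 : ℝ) 1)
    (hA : (noise {e | f (x + e) = cA}).toReal ≥ pA)
    (hhalf : pA ≥ 1 / 2)
    (δ : Fin d → ℝ)
    (hδ : Real.sqrt (∑ i, δ i ^ 2) <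
      (Finset.univ.inf' ⟨⟨0, hd⟩, Finset.mem_univ _⟩ σ) * PhiInv pA) :
    (noise {e | f (x + δ + e) = cA}).toReal > 1 / 2 := by
  subst hnoise
  set v : Fin d → NNReal := fun i => (σ i ^ 2).toNNReal with hvdef
  have hvc : ∀ i, (v i : ℝ) = σ i ^ 2 := fun i => Real.coe_toNNReal _ (sq_nonneg _)
  have hv : ∀ i, v i ≠ 0 := fun i h => by
    have h1 := hvc i
    rw [h] at h1
    have := hσ i
    simp only [NNReal.coe_zero] at h1
    nlinarith
  set A : Set (Fin d → ℝ) := {e | f (x + e) = cA} with hAdef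
  have hAm : MeasurableSet A :=
    (hf.comp (measurable_const_add x)) (measurableSet_singleton cA)
  have hset : {e | f (x + δ + e) = cA} = {e | δ + e ∈ A} := by
    ext e; simp [A, add_assoc]
  rw [hset, aux_shift _ _ _ _ hAm]
  set P := Measure.pi fun i => gaussianReal (μ i) (v i) with hP
  have hPprob : IsProbabilityMeasure P := by rw [hP]; infer_instance
  have hQd := aux_dens μ δ v hv
  rw [← hP] at hQd
  set Q := Measure.pi fun i => gaussianReal (μ i + δ i) (v i) with hQ
  have hQprob : IsProbabilityMeasure Q := by rw [hQ]; infer_instance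
  rcases hpA.2.eq_or_lt with h1 | h1
  · -- degenerate case
    have hPA : P A = 1 := by
      refine le_antisymm prob_le_one ?_
      rw [h1] at hA
      by_contra hlt
      have := (ENNReal.toReal_lt_toReal (measure_ne_top _ _) ENNReal.one_ne_top).2 (not_le.1 hlt)
      simp at this
      linarith
    have hPc : P Aᶜ = 0 := (prob_compl_eq_zero_iff hAm).2 hPA
    have hQc : Q Aᶜ = 0 := by
      rw [hQd]; exact withDensity_absolutelyContinuous _ _ hPc
    rw [(prob_compl_eq_zero_iff hAm).1 hQc]
    norm_num
  have hPhi : Phi (PhiInv pA) = pA := aux_Phi_PhiInv (by linarith) h1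
  set t := PhiInv pA with ht
  have hne : (Finset.univ : Finset (Fin d)).Nonempty := ⟨⟨0, hd⟩, Finset.mem_univ _⟩
  set r := Finset.univ.inf' ⟨⟨0, hd⟩, Finset.mem_univ _⟩ σ with hr
  have hrpos : 0 < r := by
    obtain ⟨i, _, hi⟩ := Finset.exists_mem_eq_inf' hne σ
    exact lt_of_lt_of_eq (hσ i) hi.symm
  have hrle : ∀ i, r ≤ σ i := fun i => Finset.inf'_le _ (Finset.mem_univ i)
  have htpos : 0 < t := by
    have := lt_of_le_of_lt (Real.sqrt_nonneg _) hδ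
    exact pos_of_mul_pos_right this hrpos.le
  set V := ∑ i, δ i ^ 2 / σ i ^ 2 with hV
  have hV0 : 0 ≤ V := Finset.sum_nonneg fun i _ => by positivity
  set s := Real.sqrt V with hs
  have hs2 : s ^ 2 = V := Real.sq_sqrt hV0
  have hst : s < t := by
    have h2 : V ≤ (∑ i, δ i ^ 2) / r ^ 2 := by
      rw [hV, Finset.sum_div]
      refine Finset.sum_le_sum fun i _ => ?_
      have := hrle i
      gcongr
    have h3 : s ≤ Real.sqrt (∑ i, δ i ^ 2) / r := by
      rw [hs]
      refine (Real.sqrt_le_sqrt h2).trans ?_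
      rw [Real.sqrt_div' _ (sq_nonneg r), Real.sqrt_sq hrpos.le]
    refine h3.trans_lt ?_
    rw [div_lt_iff₀ hrpos, mul_comm]
    exact hδ
  rcases (Real.sqrt_nonneg V).eq_or_lt with hs0 | hspos
  · have hVz : V = 0 := by rw [← hs2, hs, ← hs0]; norm_num
    have hδ0 : ∀ i, δ i = 0 := by
      intro i
      have := (Finset.sum_eq_zero_iff_of_nonneg (fun i _ => by positivity)).1 hVz i
        (Finset.mem_univ i)
      have hi := hσ i
      simpa [hi.ne'] using this
    have hPQ : Q = P := by rw [hQ, hP]; simp [hδ0]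
    rw [hPQ]
    have h2 := aux_Phi_strictMono htpos
    rw [aux_Phi_zero, hPhi] at h2
    linarith
  rw [← hs] at hspos
  set w : Fin d → ℝ := fun i => δ i / σ i ^ 2 with hw
  set g : (Fin d → ℝ) → ℝ := fun e => ∑ i, w i * e i with hg
  have hgm : Measurable g := by rw [hg]; fun_prop
  set c := g μ + s * t with hc
  have hvar : ((∑ i, NNReal.mk (w i ^ 2) (sq_nonneg _) * v i : NNReal) : ℝ) = s ^ 2 := by
    rw [hs2, hV]
    push_cast
    refine Finset.sum_congr rfl fun i _ => ?_
    rw [hvc]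
    have := hσ i
    simp only [hw]
    field_simp
  have hPS : (P (g ⁻¹' Set.Iic c)).toReal = Phi t := by
    rw [← Measure.map_apply hgm measurableSet_Iic, hP, hg, aux_law,
      aux_gauss_Iic _ _ hspos hvar]
    congr 1
    rw [hc]
    simp only [hg]
    field_simp
    ring
  have hQS : (Q (g ⁻¹' Set.Iic c)).toReal = Phi (t - s) := by
    rw [← Measure.map_apply hgm measurableSet_Iic, hQ, hg, aux_law,
      aux_gauss_Iic _ _ hspos hvar]
    congr 1
    have h4 : ∑ i, w i * (μ i + δ i) = g μ + s ^ 2 := by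
      rw [hs2, hV, hg]
      simp only
      rw [← Finset.sum_add_distrib]
      refine Finset.sum_congr rfl fun i _ => ?_
      simp only [hw]
      ring
    rw [h4, hc]
    field_simp
    ring
  have hexp : ∀ e : Fin d → ℝ, ∑ i, (δ i * (e i - μ i) - δ i ^ 2 / 2) / (v i : ℝ)
      = g e - g μ - s ^ 2 / 2 := by
    intro e
    rw [hs2, hV, hg]
    simp only
    rw [Finset.sum_div, ← Finset.sum_sub_distrib, ← Finset.sum_sub_distrib]
    refine Finset.sum_congr rfl fun i _ => ?_
    rw [hvc]
    simp only [hw]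
    ring
  have hNP : Q (g ⁻¹' Set.Iic c) ≤ Q A := by
    rw [hQd]
    refine aux_NP P _ A _ hAm (hgm measurableSet_Iic)
      (ENNReal.ofReal (Real.exp (s * t - s ^ 2 / 2))) ?_ ?_ ?_
    · intro e he
      rw [hexp]
      have : g e ≤ c := he
      apply ENNReal.ofReal_le_ofReal
      apply Real.exp_le_exp.2
      linarith
    · intro e he
      rw [hexp]
      have : c < g e := not_le.1 he
      apply ENNReal.ofReal_le_ofReal
      apply Real.exp_le_exp.2
      linarith
    · rw [← ENNReal.toReal_le_toReal (measure_ne_top _ _) (measure_ne_top _ _), hPS, hPhi]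
      exact hA
  have h5 := ENNReal.toReal_mono (measure_ne_top _ _) hNP
  rw [hQS] at h5
  have h6 := aux_Phi_strictMono (sub_pos.2 hst)
  rw [aux_Phi_zero] at h6
  linarith
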